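/- arXiv:2102.04631 — 3 statements merged into one kernel-verified Lean document; each statement's English description precedes it below -/
import Mathlib

section
/- Let R > 0 and let f, g : ℝ³ → ℂ be continuous functions vanishing outside the closed ball of radius R centered at 0. Then the function λ ↦ ∫_{ℝ³} ∫_{ℝ³} (exp(iλ‖x−y‖) − exp(−λ‖x−y‖)) / (8π λ² ‖x−y‖) · f(y) · g(x) dy dx is complex differentiable (holomorphic) at every λ ∈ ℂ \ {0}. (This is the analyticity of the cutoff free resolvent family asserted in Theorem 2.2.) -/
open MeasureTheory

/-- The entire part `(exp(iμt) - exp(-μt)) / t` of the resolvent kernel. -/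
noncomputable def expQuot (μ : ℂ) (t : ℝ) : ℂ :=
  (Complex.exp (Complex.I * μ * (t : ℂ)) - Complex.exp (-μ * (t : ℂ))) / (t : ℂ)

/-- The derivative of `expQuot` in the spectral parameter. -/
noncomputable def expQuotDeriv (μ : ℂ) (t : ℝ) : ℂ :=
  (Complex.exp (Complex.I * μ * (t : ℂ)) * (Complex.I * (t : ℂ)) -
    Complex.exp (-μ * (t : ℂ)) * (-(t : ℂ))) / (t : ℂ)

lemma hasDerivAt_expQuot (μ : ℂ) (t : ℝ) :
    HasDerivAt (fun ν => expQuot ν t) (expQuotDeriv μ t) μ := by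
  have h1 : HasDerivAt (fun ν : ℂ => Complex.I * ν * (t : ℂ)) (Complex.I * (t : ℂ)) μ := by
    simpa using ((hasDerivAt_id μ).const_mul Complex.I).mul_const (t : ℂ)
  have h2 : HasDerivAt (fun ν : ℂ => -ν * (t : ℂ)) (-(t : ℂ)) μ := by
    simpa using ((hasDerivAt_id μ).neg).mul_const (t : ℂ)
  exact (h1.cexp.sub h2.cexp).div_const _

lemma norm_expQuotDeriv_le {M T : ℝ} {μ : ℂ} {t : ℝ} (hμ : ‖μ‖ ≤ M) (ht : 0 ≤ t)
    (htT : t ≤ T) : ‖expQuotDeriv μ t‖ ≤ 2 * Real.exp (M * T) := by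
  have hM : 0 ≤ M := (norm_nonneg _).trans hμ
  rcases ht.eq_or_lt with rfl | ht'
  · simp [expQuotDeriv]; positivity
  have hexp : ∀ z : ℂ, ‖z‖ = ‖μ‖ * t → ‖Complex.exp z‖ ≤ Real.exp (M * T) := fun z hz =>
    (Complex.norm_exp_le_exp_norm z).trans (Real.exp_le_exp.2 (hz ▸ by gcongr))
  have htc : (t : ℂ) ≠ 0 := by exact_mod_cast ht'.ne'
  have heq : expQuotDeriv μ t =
      Complex.exp (Complex.I * μ * t) * Complex.I + Complex.exp (-μ * t) := by
    unfold expQuotDeriv; field_simp; ring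
  rw [heq, two_mul]
  refine (norm_add_le _ _).trans (add_le_add ?_ ?_)
  · rw [norm_mul, Complex.norm_I, mul_one]
    exact hexp _ (by simp [abs_of_nonneg ht])
  · exact hexp _ (by simp [abs_of_nonneg ht])

lemma norm_expQuot_le {T : ℝ} {μ : ℂ} {t : ℝ} (ht : 0 ≤ t) (htT : t ≤ T) :
    ‖expQuot μ t‖ ≤ 2 * Real.exp (‖μ‖ * T) * ‖μ‖ := by
  have h := (convex_closedBall (0 : ℂ) ‖μ‖).norm_image_sub_le_of_norm_hasDerivWithin_le
    (f := fun ν => expQuot ν t) (f' := fun ν => expQuotDeriv ν t) (C := 2 * Real.exp (‖μ‖ * T))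
    (x := 0) (y := μ) (fun ν _ => (hasDerivAt_expQuot ν t).hasDerivWithinAt)
    (fun ν hν => norm_expQuotDeriv_le (by simpa using hν) ht htT) (by simp) (by simp)
  simpa [expQuot] using h

section BilinearForm

variable {E : Type*} [NormedAddCommGroup E]

lemma norm_kernel_mul_le {R C : ℝ} {f g : E → ℂ}
    (hfs : ∀ x, x ∉ Metric.closedBall (0 : E) R → f x = 0)
    (hgs : ∀ x, x ∉ Metric.closedBall (0 : E) R → g x = 0) {k : ℝ → ℂ}
    (hk : ∀ t, 0 ≤ t → t ≤ 2 * R → ‖k t‖ ≤ C) (x y : E) :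
    ‖k ‖x - y‖ * f y * g x‖ ≤ C * (‖g x‖ * ‖f y‖) := by
  by_cases hx : x ∈ Metric.closedBall (0 : E) R
  · by_cases hy : y ∈ Metric.closedBall (0 : E) R
    · rw [mem_closedBall_zero_iff] at hx hy
      have h := hk ‖x - y‖ (norm_nonneg _) (by linarith [norm_sub_le x y])
      rw [norm_mul, norm_mul, mul_assoc, mul_comm ‖f y‖]
      gcongr
    · simp [hfs y hy]
  · simp [hgs x hx]

variable [MeasurableSpace E] [BorelSpace E] [SecondCountableTopology E]

lemma aestronglyMeasurable_kernel_mul {ν : Measure (E × E)} {f g : E → ℂ} (hf : Continuous f)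
    (hg : Continuous g) {k : ℝ → ℂ} (hk : Measurable k) :
    AEStronglyMeasurable (fun p : E × E => k ‖p.1 - p.2‖ * f p.2 * g p.1) ν := by
  have hf' := hf.measurable
  have hg' := hg.measurable
  exact Measurable.aestronglyMeasurable (by fun_prop)

lemma differentiable_integral_expQuot [ProperSpace E] {m : Measure E}
    [IsFiniteMeasureOnCompacts m] [SFinite m] {R : ℝ} {f g : E → ℂ} (hf : Continuous f)
    (hg : Continuous g) (hfs : ∀ x, x ∉ Metric.closedBall (0 : E) R → f x = 0)
    (hgs : ∀ x, x ∉ Metric.closedBall (0 : E) R → g x = 0) :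
    Differentiable ℂ (fun μ : ℂ =>
      ∫ x, ∫ y, expQuot μ ‖x - y‖ * f y * g x ∂m ∂m) := by
  have hfi : Integrable f m :=
    hf.integrable_of_hasCompactSupport (.intro (isCompact_closedBall 0 R) hfs)
  have hgi : Integrable g m :=
    hg.integrable_of_hasCompactSupport (.intro (isCompact_closedBall 0 R) hgs)
  have hmeas (μ : ℂ) : Measurable (expQuot μ) := by unfold expQuot; fun_prop
  have hmeas' (μ : ℂ) : Measurable (expQuotDeriv μ) := by unfold expQuotDeriv; fun_prop
  have hdom (C : ℝ) : Integrable (fun p : E × E => C * (‖g p.1‖ * ‖f p.2‖)) (m.prod m) :=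
    (hgi.norm.mul_prod hfi.norm).const_mul C
  have hint (μ : ℂ) : Integrable (fun p : E × E => expQuot μ ‖p.1 - p.2‖ * f p.2 * g p.1)
      (m.prod m) :=
    (hdom _).mono' (aestronglyMeasurable_kernel_mul hf hg (hmeas μ))
      (.of_forall fun p => norm_kernel_mul_le hfs hgs
        (fun t ht htT => norm_expQuot_le ht htT) p.1 p.2)
  intro lam
  have heq : (fun μ : ℂ => ∫ x, ∫ y, expQuot μ ‖x - y‖ * f y * g x ∂m ∂m) =
      fun μ => ∫ p : E × E, expQuot μ ‖p.1 - p.2‖ * f p.2 * g p.1 ∂(m.prod m) :=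
    funext fun μ => (integral_prod _ (hint μ)).symm
  rw [heq]
  refine (hasDerivAt_integral_of_dominated_loc_of_deriv_le
    (F' := fun μ p => expQuotDeriv μ ‖p.1 - p.2‖ * f p.2 * g p.1)
    (bound := fun p => 2 * Real.exp ((‖lam‖ + 1) * (2 * R)) * (‖g p.1‖ * ‖f p.2‖))
    (Metric.ball_mem_nhds lam one_pos)
    (.of_forall fun μ => aestronglyMeasurable_kernel_mul hf hg (hmeas μ)) (hint lam)
    (aestronglyMeasurable_kernel_mul hf hg (hmeas' lam))
    (.of_forall fun p μ hμ => ?_) (hdom _)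
    (.of_forall fun p μ _ => ((hasDerivAt_expQuot μ _).mul_const _).mul_const _)).2.differentiableAt
  have hμ' : ‖μ‖ ≤ ‖lam‖ + 1 := by
    rw [mem_ball_iff_norm] at hμ
    linarith [norm_le_norm_add_norm_sub' μ lam]
  exact norm_kernel_mul_le hfs hgs (fun t ht htT => norm_expQuotDeriv_le hμ' ht htT) p.1 p.2

end BilinearForm

/-- Analyticity of the cutoff free resolvent family: for continuous `f, g` supported in the
closed ball of radius `R`, the map
`λ ↦ ∬ R₀(λ,x,y) f(y) g(x) dy dx` is holomorphic on `ℂ \ {0}`. -/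
theorem cutoff_resolvent_analytic (R : ℝ) (hR : 0 < R)
    (f g : EuclideanSpace ℝ (Fin 3) → ℂ) (hf : Continuous f) (hg : Continuous g)
    (hfs : ∀ x, x ∉ Metric.closedBall (0 : EuclideanSpace ℝ (Fin 3)) R → f x = 0)
    (hgs : ∀ x, x ∉ Metric.closedBall (0 : EuclideanSpace ℝ (Fin 3)) R → g x = 0)
    (lam : ℂ) (hlam : lam ≠ 0) :
    DifferentiableAt ℂ (fun μ : ℂ =>
      ∫ x : EuclideanSpace ℝ (Fin 3), ∫ y : EuclideanSpace ℝ (Fin 3),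
        (Complex.exp (Complex.I * μ * (‖x - y‖ : ℂ)) - Complex.exp (-μ * (‖x - y‖ : ℂ))) /
          (8 * (Real.pi : ℂ) * μ ^ 2 * (‖x - y‖ : ℂ)) * f y * g x) lam := by
  have hfun : (fun μ : ℂ =>
      ∫ x : EuclideanSpace ℝ (Fin 3), ∫ y : EuclideanSpace ℝ (Fin 3),
        (Complex.exp (Complex.I * μ * (‖x - y‖ : ℂ)) - Complex.exp (-μ * (‖x - y‖ : ℂ))) /
          (8 * (Real.pi : ℂ) * μ ^ 2 * (‖x - y‖ : ℂ)) * f y * g x) =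
      fun μ => (8 * (Real.pi : ℂ) * μ ^ 2)⁻¹ *
        ∫ x : EuclideanSpace ℝ (Fin 3), ∫ y : EuclideanSpace ℝ (Fin 3),
          expQuot μ ‖x - y‖ * f y * g x := by
    funext μ
    simp_rw [← integral_const_mul, expQuot, div_eq_mul_inv, mul_inv]
    congr! 4
    ring
  rw [hfun]
  refine .mul (.inv (by fun_prop) ?_) (differentiable_integral_expQuot hf hg hfs hgs lam)
  simp [hlam, Real.pi_ne_zero]
end

section
/- Let λ ∈ ℂ with λ ≠ 0 and y ∈ ℝ³, and define u : ℝ³ → ℂ by u(x) = (exp(iλ‖x−y‖) − exp(−λ‖x−y‖)) / (8π λ² ‖x−y‖) for x ≠ y (and arbitrarily at x = y). Then for every x ≠ y, Δ(Δu)(x) = λ⁴ · u(x); that is, the free resolvent kernel R₀(λ, ·, y) solves the homogeneous equation Δ²u − λ⁴ u = 0 away from the singularity. -/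
/-- The Laplacian on `ℝ³`: the trace of the second Fréchet derivative, computed as the sum
of the pure second derivatives along the standard orthonormal basis. -/
noncomputable def lap (f : EuclideanSpace ℝ (Fin 3) → ℂ) (x : EuclideanSpace ℝ (Fin 3)) : ℂ :=
  ∑ i : Fin 3,
    fderiv ℝ (fun y => fderiv ℝ f y (EuclideanSpace.single i (1 : ℝ))) x
      (EuclideanSpace.single i (1 : ℝ))

lemma hasFDerivAt_norm_sub {E : Type*} [NormedAddCommGroup E] [InnerProductSpace ℝ E]
    {x y : E} (hxy : x ≠ y) :
    HasFDerivAt (fun z => ‖z - y‖) (‖x - y‖⁻¹ • innerSL ℝ (x - y)) x := by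
  have hr : ‖x - y‖ ≠ 0 := norm_ne_zero_iff.2 (sub_ne_zero.2 hxy)
  have h := (((hasFDerivAt_id (𝕜 := ℝ) x).sub_const y).norm_sq).sqrt (pow_ne_zero 2 hr)
  simp only [id, Real.sqrt_sq (norm_nonneg _)] at h
  refine h.congr_fderiv ?_
  ext v
  simp
  field_simp

/-- The Laplacian of a function of the form `x ↦ G ‖x - y‖ / ‖x - y‖` away from `y`. -/
lemma lap_radial_div_norm (y : EuclideanSpace ℝ (Fin 3)) (f : EuclideanSpace ℝ (Fin 3) → ℂ)
    (G G₁ G₂ : ℝ → ℂ) (hG : ∀ r, HasDerivAt G (G₁ r) r) (hG₁ : ∀ r, HasDerivAt G₁ (G₂ r) r)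
    (hf : ∀ x, x ≠ y → f x = G ‖x - y‖ / (‖x - y‖ : ℂ)) (x : EuclideanSpace ℝ (Fin 3))
    (hx : x ≠ y) : lap f x = G₂ ‖x - y‖ / (‖x - y‖ : ℂ) := by
  have hid (r : ℝ) : HasDerivAt (fun s : ℝ => (s : ℂ)) 1 r := Complex.ofRealCLM.hasDerivAt
  have hpos {z : EuclideanSpace ℝ (Fin 3)} (hz : z ≠ y) : ‖z - y‖ ≠ 0 :=
    norm_ne_zero_iff.2 (sub_ne_zero.2 hz)
  have hnhds {z : EuclideanSpace ℝ (Fin 3)} (hz : z ≠ y) : ∀ᶠ w in nhds z, w ≠ y :=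
    isOpen_ne.mem_nhds hz
  let H : ℝ → ℂ := fun r => G₁ r / (r : ℂ) ^ 2 - G r / (r : ℂ) ^ 3
  have hH {r : ℝ} (hr : r ≠ 0) : HasDerivAt H
      (G₂ r / (r : ℂ) ^ 2 - 3 * G₁ r / (r : ℂ) ^ 3 + 3 * G r / (r : ℂ) ^ 4) r := by
    have hr' : (r : ℂ) ≠ 0 := Complex.ofReal_ne_zero.2 hr
    refine (((hG₁ r).div ((hid r).pow 2) (pow_ne_zero 2 hr')).sub
      ((hG r).div ((hid r).pow 3) (pow_ne_zero 3 hr'))).congr_deriv ?_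
    simp only [Pi.pow_apply]
    field_simp
    push_cast
    ring
  have hgrad {z : EuclideanSpace ℝ (Fin 3)} (hz : z ≠ y) (i : Fin 3) :
      fderiv ℝ f z (EuclideanSpace.single i (1 : ℝ)) = H ‖z - y‖ * ((z i - y i : ℝ) : ℂ) := by
    have hr' : (‖z - y‖ : ℂ) ≠ 0 := Complex.ofReal_ne_zero.2 (hpos hz)
    have h := (((hG ‖z - y‖).div (hid _) hr').hasFDerivAt.comp z (hasFDerivAt_norm_sub hz))
    have h' := h.congr_of_eventuallyEq ((hnhds hz).mono fun w hw => hf w hw)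
    rw [h'.fderiv]
    simp [H, EuclideanSpace.inner_single_right]
    field_simp
  have hsecond (i : Fin 3) :
      fderiv ℝ (fun z => fderiv ℝ f z (EuclideanSpace.single i (1 : ℝ))) x
        (EuclideanSpace.single i (1 : ℝ)) =
      (G₂ ‖x - y‖ / (‖x - y‖ : ℂ) ^ 2 - 3 * G₁ ‖x - y‖ / (‖x - y‖ : ℂ) ^ 3
        + 3 * G ‖x - y‖ / (‖x - y‖ : ℂ) ^ 4) / (‖x - y‖ : ℂ) * ((x i - y i : ℝ) : ℂ) ^ 2
        + H ‖x - y‖ := by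
    have hcoord : HasFDerivAt (fun z : EuclideanSpace ℝ (Fin 3) => ((z i - y i : ℝ) : ℂ))
        (Complex.ofRealCLM ∘L EuclideanSpace.proj i) x :=
      Complex.ofRealCLM.hasFDerivAt.comp x
        ((EuclideanSpace.proj (𝕜 := ℝ) i).hasFDerivAt.sub_const (y i))
    have h := ((hH (hpos hx)).hasFDerivAt.comp x (hasFDerivAt_norm_sub hx)).mul hcoord
    have h' := h.congr_of_eventuallyEq ((hnhds hx).mono fun w hw => hgrad hw i)
    rw [h'.fderiv]
    simp [EuclideanSpace.inner_single_right]
    ring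
  have hr' : (‖x - y‖ : ℂ) ≠ 0 := Complex.ofReal_ne_zero.2 (hpos hx)
  have hsum : ∑ i : Fin 3, ((x i - y i : ℝ) : ℂ) ^ 2 = (‖x - y‖ : ℂ) ^ 2 := by
    have := EuclideanSpace.real_norm_sq_eq (x - y)
    simp only [PiLp.sub_apply] at this
    exact_mod_cast this.symm
  simp only [lap, hsecond, Finset.sum_add_distrib, ← Finset.mul_sum, hsum]
  simp [H]
  field_simp
  ring

/-- The functions `(A exp (a r) + B exp (b r)) / r` of `r = ‖x - y‖` are mapped by the Laplacian
to functions of the same form. -/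
lemma lap_exp_add_exp_div_norm (y : EuclideanSpace ℝ (Fin 3)) (f : EuclideanSpace ℝ (Fin 3) → ℂ)
    (A B a b : ℂ)
    (hf : ∀ x, x ≠ y → f x = (A * Complex.exp (a * (‖x - y‖ : ℂ)) +
      B * Complex.exp (b * (‖x - y‖ : ℂ))) / (‖x - y‖ : ℂ))
    (x : EuclideanSpace ℝ (Fin 3)) (hx : x ≠ y) :
    lap f x = (A * a ^ 2 * Complex.exp (a * (‖x - y‖ : ℂ)) +
      B * b ^ 2 * Complex.exp (b * (‖x - y‖ : ℂ))) / (‖x - y‖ : ℂ) := by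
  have hexp (C c : ℂ) (r : ℝ) : HasDerivAt (fun s : ℝ => C * Complex.exp (c * (s : ℂ)))
      (C * c * Complex.exp (c * (r : ℂ))) r := by
    have hid : HasDerivAt (fun s : ℝ => (s : ℂ)) 1 r := Complex.ofRealCLM.hasDerivAt
    exact (((hid.const_mul c).cexp).const_mul C).congr_deriv (by ring)
  refine lap_radial_div_norm y f
    (fun r => A * Complex.exp (a * (r : ℂ)) + B * Complex.exp (b * (r : ℂ)))
    (fun r => A * a * Complex.exp (a * (r : ℂ)) + B * b * Complex.exp (b * (r : ℂ)))
    (fun r => A * a ^ 2 * Complex.exp (a * (r : ℂ)) + B * b ^ 2 * Complex.exp (b * (r : ℂ)))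
    (fun r => (hexp A a r).add (hexp B b r))
    (fun r => ((hexp (A * a) a r).add (hexp (B * b) b r)).congr_deriv (by ring)) hf x hx

/-- The free resolvent kernel `R₀(λ, ·, y)` solves `Δ²u - λ⁴u = 0` away from the
singularity `x = y`. -/
theorem free_kernel_biharmonic (lam : ℂ) (hlam : lam ≠ 0) (y : EuclideanSpace ℝ (Fin 3))
    (u : EuclideanSpace ℝ (Fin 3) → ℂ)
    (hu : ∀ x, x ≠ y →
      u x = (Complex.exp (Complex.I * lam * (‖x - y‖ : ℂ)) -
        Complex.exp (-lam * (‖x - y‖ : ℂ))) /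
        (8 * (Real.pi : ℂ) * lam ^ 2 * (‖x - y‖ : ℂ))) :
    ∀ x, x ≠ y → lap (lap u) x = lam ^ 4 * u x := by
  intro x hx
  let c : ℂ := (8 * (Real.pi : ℂ) * lam ^ 2)⁻¹
  have hform : ∀ z, z ≠ y → u z = (c * Complex.exp (Complex.I * lam * (‖z - y‖ : ℂ)) +
      (-c) * Complex.exp (-lam * (‖z - y‖ : ℂ))) / (‖z - y‖ : ℂ) := by
    intro z hz
    rw [hu z hz, ← div_div, div_eq_mul_inv _ (8 * (Real.pi : ℂ) * lam ^ 2)]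
    ring
  rw [lap_exp_add_exp_div_norm y (lap u) _ _ _ _
    (lap_exp_add_exp_div_norm y u _ _ _ _ hform) x hx, hform x hx]
  linear_combination (c * lam ^ 4 * Complex.exp (Complex.I * lam * (‖x - y‖ : ℂ)) /
    (‖x - y‖ : ℂ)) * Complex.I_pow_four
end

section
/- (Analytic Fredholm theory, Theorem 3.1.) Let X be a complex Banach space, let D ⊆ ℂ be an open connected set, and let A : ℂ → B(X) be a map into the bounded linear operators on X that is holomorphic on D and such that A(z) is a compact operator for each z ∈ D. Then either (a) the operator I − A(z) is not invertible (in B(X)) for any z ∈ D, or (b) there exists a subset S of D that is discrete in D (i.e., every point of D has a neighborhood meeting S in at most that point) such that I − A(z) is invertible for all z ∈ D \ S. -/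
open Filter Topology in
theorem Filter.forall_eventually_or_forall_eventually_nhdsNE {α : Type*} [TopologicalSpace α]
    [T1Space α] [∀ x : α, (𝓝[≠] x).NeBot] {D : Set α} (hD : IsPreconnected D) {P : α → Prop}
    (h : ∀ x ∈ D, (∀ᶠ y in 𝓝 x, ¬ P y) ∨ ∀ᶠ y in 𝓝[≠] x, P y) :
    (∀ x ∈ D, ∀ᶠ y in 𝓝 x, ¬ P y) ∨ ∀ x ∈ D, ∀ᶠ y in 𝓝[≠] x, P y := by
  refine hD.subset_or_subset (u := {x | ∀ᶠ y in 𝓝 x, ¬ P y}) (v := {x | ∀ᶠ y in 𝓝[≠] x, P y})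
    isOpen_setOfPred_eventually_nhds isOpen_setOfPred_eventually_nhdsWithin ?_ h
  refine Set.disjoint_left.mpr fun x hx hx' => ?_
  obtain ⟨y, hy, hy'⟩ := ((hx.filter_mono nhdsWithin_le_nhds).and hx').exists
  exact hy hy'

theorem ContinuousLinearMap.differentiable_det {𝕜 V : Type*} [NontriviallyNormedField 𝕜]
    [CompleteSpace 𝕜] [NormedAddCommGroup V] [NormedSpace 𝕜 V] [FiniteDimensional 𝕜 V] :
    Differentiable 𝕜 fun f : V →L[𝕜] V => f.det := by
  let b := Module.finBasis 𝕜 V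
  have entry (i j) : Differentiable 𝕜 fun f : V →L[𝕜] V => LinearMap.toMatrix b b f i j := by
    have : (fun f : V →L[𝕜] V => LinearMap.toMatrix b b f i j) =
        fun f => (b.coord i).toContinuousLinearMap (f (b j)) := by
      ext f
      simp [LinearMap.toMatrix_apply]
    rw [this]
    fun_prop
  have : (fun f : V →L[𝕜] V => f.det) =
      fun f : V →L[𝕜] V => (LinearMap.toMatrix b b f).det := by
    ext f
    exact (LinearMap.det_toMatrix b _).symm
  rw [this]
  simp only [Matrix.det_apply]
  fun_prop

/-- **Sylvester's determinant criterion** for a perturbation factoring through a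
finite-dimensional space. -/
theorem ContinuousLinearMap.injective_one_sub_comp_iff_det_ne_zero {𝕜 X V : Type*}
    [NontriviallyNormedField 𝕜] [NormedAddCommGroup X] [NormedSpace 𝕜 X]
    [NormedAddCommGroup V] [NormedSpace 𝕜 V] [FiniteDimensional 𝕜 V]
    (φ : V →L[𝕜] X) (p : X →L[𝕜] V) :
    Function.Injective (1 - φ ∘L p : X →L[𝕜] X) ↔ (1 - p ∘L φ : V →L[𝕜] V).det ≠ 0 := by
  rw [ContinuousLinearMap.det, Ne, LinearMap.det_eq_zero_iff_ker_ne_bot, not_not,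
    LinearMap.ker_eq_bot', injective_iff_map_eq_zero]
  constructor
  · intro h v hv
    replace hv : v = p (φ v) := by simpa [sub_eq_zero] using hv
    have := h (φ v) (by simp [← hv])
    rw [hv, this, map_zero]
  · intro h x hx
    replace hx : x = φ (p x) := by simpa [sub_eq_zero] using hx
    have := h (p x) (by simp [← hx])
    rw [hx, this, map_zero]

namespace IsCompactOperator

variable {𝕜 X : Type*} [NormedAddCommGroup X]

section NontriviallyNormedField

variable [NontriviallyNormedField 𝕜] [NormedSpace 𝕜 X] {K : X →L[𝕜] X}

theorem finiteDimensional_ker_one_sub [CompleteSpace 𝕜] (hK : IsCompactOperator K) :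
    FiniteDimensional 𝕜 (1 - K).ker := by
  have hfix (x) (hx : x ∈ (1 - K).ker) : K x = x :=
    (sub_eq_zero.mp (show x - K x = 0 from hx)).symm
  refine FiniteDimensional.of_isCompactOperator_id (𝕜 := 𝕜) ?_
  have hcomp := IsCompactOperator.restrict (f := (K : X →ₗ[𝕜] X)) hK (V := (1 - K).ker)
    (fun x hx => by rwa [ContinuousLinearMap.coe_coe, hfix x hx]) (1 - K).isClosed_ker
  refine (congrArg IsCompactOperator (funext fun x => ?_)).mp hcomp
  exact Subtype.ext (hfix x x.2)

variable [CompleteSpace X]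

theorem isUnit_one_sub_of_injective (hK : IsCompactOperator K)
    (h : Function.Injective (1 - K : X →L[𝕜] X)) : IsUnit (1 - K : X →L[𝕜] X) := by
  have := (hK.hasEigenvalue_or_mem_resolventSet one_ne_zero).resolve_left fun he => by
    obtain ⟨x, hx⟩ := he.exists_hasEigenvector
    refine hx.2 (h ?_)
    have : K x = x := by simpa using hx.apply_eq_smul
    simp [this]
  simpa [spectrum.mem_resolventSet_iff] using this

end NontriviallyNormedField

variable [RCLike 𝕜] [NormedSpace 𝕜 X] [CompleteSpace X] {K : X →L[𝕜] X}

theorem isUnit_one_sub_of_surjective (hK : IsCompactOperator K)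
    (h : Function.Surjective (1 - K : X →L[𝕜] X)) : IsUnit (1 - K : X →L[𝕜] X) := by
  have := hK.finiteDimensional_ker_one_sub
  obtain ⟨p, hp⟩ := Submodule.ClosedComplemented.of_finiteDimensional (1 - K).ker
  let e := (1 - K).equivProdOfSurjectiveOfIsCompl p (LinearMap.range_eq_top.mpr h)
    (LinearMap.range_eq_top.mpr fun x => ⟨x, hp x⟩) (LinearMap.isCompl_of_proj hp)
  let R : X →L[𝕜] X := e.symm.toContinuousLinearMap ∘L ContinuousLinearMap.inl 𝕜 X (1 - K).ker
  have hR : (1 - K) * R = 1 := by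
    ext x
    exact congr($(e.apply_symm_apply (x, 0)).1)
  -- The right inverse is itself an injective compact perturbation of the identity.
  have hRK : R = 1 - -(K * R) := by
    rw [sub_mul, one_mul] at hR
    rw [sub_neg_eq_add, ← hR, sub_add_cancel]
  have hRu : IsUnit R := by
    rw [hRK]
    refine isUnit_one_sub_of_injective (hK.comp_clm R).neg ?_
    rw [← hRK]
    exact Function.LeftInverse.injective (g := ⇑(1 - K)) fun x => DFunLike.congr_fun hR x
  obtain ⟨u, hu⟩ := hRu
  rw [← hu] at hR
  exact Units.eq_inv_of_mul_eq_one_right hR ▸ u⁻¹.isUnit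

/-- If `K` is compact then `1 - K` becomes invertible after adding an operator that factors
through its finite-dimensional kernel. -/
theorem exists_isUnit_one_sub_add_comp (hK : IsCompactOperator K) :
    ∃ (φ : (1 - K).ker →L[𝕜] X) (p : X →L[𝕜] (1 - K).ker), IsUnit (1 - K + φ ∘L p) := by
  have := hK.finiteDimensional_ker_one_sub
  obtain ⟨p, hp⟩ := Submodule.ClosedComplemented.of_finiteDimensional (1 - K).ker
  obtain ⟨C, hC⟩ := (1 - K).range.exists_isCompl
  have key (φ : (1 - K).ker →ₗ[𝕜] C) (hφ : Function.Injective φ ∨ Function.Surjective φ) :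
      ∃ (φ : (1 - K).ker →L[𝕜] X) (p : X →L[𝕜] (1 - K).ker), IsUnit (1 - K + φ ∘L p) := by
    let φ' : (1 - K).ker →L[𝕜] X := (C.subtype ∘ₗ φ).toContinuousLinearMap
    refine ⟨φ', p, ?_⟩
    have hcomp : IsCompactOperator (K - φ' ∘L p : X →L[𝕜] X) :=
      hK.sub (.comp_clm (isCompactOperator_of_locallyCompactSpace_rng φ') p)
    have heq : 1 - K + φ' ∘L p = 1 - (K - φ' ∘L p) := by abel
    rw [heq]
    rcases hφ with hφ | hφ
    · refine isUnit_one_sub_of_injective hcomp ((injective_iff_map_eq_zero _).mpr fun x hx => ?_)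
      rw [← heq] at hx
      replace hx : (1 - K) x + (φ (p x) : X) = 0 := hx
      have h0 := Submodule.disjoint_def.mp hC.disjoint ((1 - K) x) ⟨x, rfl⟩
        (by rw [eq_neg_of_add_eq_zero_left hx]; exact C.neg_mem (φ (p x)).2)
      have hpx : p x = 0 := hφ (by rw [map_zero]; simpa [h0] using hx)
      exact congr(Subtype.val $((hp ⟨x, h0⟩).symm.trans hpx))
    · refine isUnit_one_sub_of_surjective hcomp fun y => ?_
      rw [← heq]
      obtain ⟨_, ⟨x, rfl⟩, c, hc, rfl⟩ :=
        Submodule.mem_sup.mp (hC.sup_eq_top ▸ Submodule.mem_top (x := y))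
      obtain ⟨k, hk⟩ := hφ ⟨c, hc⟩
      refine ⟨x - p x + k, ?_⟩
      have h1 : (1 - K) (p x : X) = 0 := (p x).2
      have h2 : (1 - K) (k : X) = 0 := k.2
      have h3 : φ' k = c := congr(($hk : X))
      have h4 : p (x - p x + k) = k := by
        rw [map_add, map_sub, hp, hp, sub_self, zero_add]
      change (1 - K) (x - p x + k) + φ' (p (x - p x + k)) = (1 - K) x + c
      rw [h4, h3, map_add, map_sub, h1, h2, sub_zero, add_zero]
  rcases le_total (Module.rank 𝕜 (1 - K).ker) (Module.rank 𝕜 C) with h | h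
  · obtain ⟨φ, hφ⟩ := rank_le_iff_exists_linearMap.mp h
    exact key φ (.inl hφ)
  · obtain ⟨ψ, hψ⟩ := rank_le_iff_exists_linearMap.mp h
    obtain ⟨φ, hφ⟩ := ψ.exists_leftInverse_of_injective (LinearMap.ker_eq_bot.mpr hψ)
    exact key φ (.inr fun c => ⟨ψ c, congr($hφ c)⟩)

end IsCompactOperator

open Filter Topology in
/-- The local form of the analytic Fredholm theorem: near `z₀`, invertibility of `1 - A z` is
governed by the zeros of an analytic scalar function. -/
theorem eventually_not_isUnit_or_eventually_isUnit_one_sub {X : Type*} [NormedAddCommGroup X]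
    [NormedSpace ℂ X] [CompleteSpace X] {A : ℂ → X →L[ℂ] X} {z₀ : ℂ}
    (hA : ∀ᶠ z in 𝓝 z₀, DifferentiableAt ℂ A z) (hcomp : ∀ᶠ z in 𝓝 z₀, IsCompactOperator (A z)) :
    (∀ᶠ z in 𝓝 z₀, ¬ IsUnit (1 - A z)) ∨ ∀ᶠ z in 𝓝[≠] z₀, IsUnit (1 - A z) := by
  have := hcomp.self_of_nhds.finiteDimensional_ker_one_sub
  obtain ⟨φ, p, hu⟩ := hcomp.self_of_nhds.exists_isUnit_one_sub_add_comp
  let B (z : ℂ) : X →L[ℂ] X := 1 - A z + φ ∘L p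
  have hB : ∀ᶠ z in 𝓝 z₀, IsUnit (B z) := by
    have hcont : ContinuousAt B z₀ := by
      have := hA.self_of_nhds.continuousAt
      fun_prop
    exact hcont (Units.isOpen.mem_nhds hu)
  let d (z : ℂ) : ℂ := (1 - p ∘L (Ring.inverse (B z) ∘L φ)).det
  have hd : AnalyticAt ℂ d z₀ := by
    rw [Complex.analyticAt_iff_eventually_differentiableAt]
    filter_upwards [hA, hB] with z hz hBz
    have hinv : DifferentiableAt ℂ (fun z => Ring.inverse (B z)) z :=
      DifferentiableAt.comp z (differentiableAt_inverse hBz) (by fun_prop)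
    exact DifferentiableAt.comp z (g := fun f => ContinuousLinearMap.det f)
      ContinuousLinearMap.differentiable_det.differentiableAt
      (f := fun z => 1 - p ∘L (Ring.inverse (B z) ∘L φ)) (by fun_prop)
  have hiff : ∀ᶠ z in 𝓝 z₀, IsUnit (1 - A z) ↔ d z ≠ 0 := by
    filter_upwards [hcomp, hB] with z hz hBz
    have hfac : 1 - A z = B z * (1 - (Ring.inverse (B z) ∘L φ) ∘L p) := by
      have : B z * ((Ring.inverse (B z) ∘L φ) ∘L p) = φ ∘L p :=
        Ring.mul_inverse_cancel_left (B z) (φ ∘L p) hBz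
      rw [mul_sub, mul_one, this]
      simp [B]
    rw [← ContinuousLinearMap.injective_one_sub_comp_iff_det_ne_zero]
    have hinj := (ContinuousLinearMap.isUnit_iff_bijective.mp hBz).injective
    rw [← hinj.of_comp_iff, ← ContinuousLinearMap.coe_comp, ← ContinuousLinearMap.mul_def, ← hfac]
    exact ⟨fun h => (ContinuousLinearMap.isUnit_iff_bijective.mp h).injective,
      hz.isUnit_one_sub_of_injective⟩
  rcases hd.eventually_eq_zero_or_eventually_ne_zero with h | h
  · left
    filter_upwards [h, hiff] with z h₀ hz
    simp [hz, h₀]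
  · right
    filter_upwards [h, hiff.filter_mono nhdsWithin_le_nhds] with z h₀ hz
    exact hz.mpr h₀

/-- Analytic Fredholm theory (Theorem 3.1): if `A : D → B(X)` is holomorphic on an open
connected set `D ⊆ ℂ` with `A(z)` compact for each `z ∈ D`, then either `I - A(z)` is
invertible for no `z ∈ D`, or it is invertible for all `z` outside a subset of `D` that is
discrete in `D`. -/
theorem analytic_fredholm {X : Type*} [NormedAddCommGroup X] [NormedSpace ℂ X]
    [CompleteSpace X] (D : Set ℂ) (hD : IsOpen D) (hDconn : IsConnected D)
    (A : ℂ → X →L[ℂ] X) (hA : ∀ z ∈ D, DifferentiableAt ℂ A z)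
    (hAcomp : ∀ z ∈ D, IsCompactOperator (A z)) :
    (∀ z ∈ D, ¬ IsUnit ((1 : X →L[ℂ] X) - A z)) ∨
      ∃ S ⊆ D, (∀ z ∈ D, ∃ U ∈ nhds z, U ∩ S ⊆ {z}) ∧
        ∀ z ∈ D \ S, IsUnit ((1 : X →L[ℂ] X) - A z) := by
  have hloc (z) (hz : z ∈ D) := eventually_not_isUnit_or_eventually_isUnit_one_sub
    ((hD.eventually_mem hz).mono hA) ((hD.eventually_mem hz).mono hAcomp)
  rcases Filter.forall_eventually_or_forall_eventually_nhdsNE hDconn.isPreconnected hloc with h | h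
  · exact .inl fun z hz => (h z hz).self_of_nhds
  · refine .inr ⟨{z ∈ D | ¬ IsUnit (1 - A z)}, Set.sep_subset _ _, fun z hz => ?_,
      fun z hz => by_contra fun hu => hz.2 ⟨hz.1, hu⟩⟩
    exact ⟨_, eventually_nhdsWithin_iff.mp (h z hz),
      fun w hw => by_contra fun hne => hw.2.2 (hw.1 hne)⟩
end
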